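/- Let r ≥ 3 be fixed and let G be a uniformly random simple r-regular graph on n vertices. Let M be the non-backtracking walk Markov chain on the rn oriented edges of G (from state (u,v) the walk moves to a state (v,w) with w a neighbour of v, w ≠ u, chosen uniformly at random), made lazy by staying put with probability 1/2 at each step. Then there is a constant C such that with high probability (over G), for all t ≥ C·log n and all oriented edges e, f, the t-step transition probability satisfies |P^t_e(f) − 1/(rn)| ≤ n^{−4}; i.e. the mixing time of the chain is O(log n). (Lemma 6.) -/

import Mathlib

open Filter Finset
open scoped Classical

noncomputable section

/-- The set of `r`-regular simple graphs on `Fin n`. -/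
def regSet (r n : ℕ) : Finset (SimpleGraph (Fin n)) :=
  Finset.univ.filter fun G => ∀ v : Fin n, Nat.card (G.neighborSet v) = r

/-- Probability of an event under the uniform measure on `r`-regular graphs on `Fin n`. -/
def graphProb (r n : ℕ) (E : SimpleGraph (Fin n) → Prop) : ℝ :=
  ((regSet r n).filter E).card / (regSet r n).card

/-- The filter of `n → ∞` along which `r`-regular graphs on `n` vertices exist. -/
def regFilter (r : ℕ) : Filter ℕ := atTop ⊓ Filter.principal {n | Even (r * n)}

/-- Transition matrix of the lazy non-backtracking walk chain on the oriented
edges (darts) of `G`: stay put with probability `1/2`, otherwise move from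
`(u,v)` to a uniformly random `(v,w)` with `w ≠ u`. -/
def nbLazy {n : ℕ} (r : ℕ) (G : SimpleGraph (Fin n)) : Matrix G.Dart G.Dart ℝ :=
  Matrix.of fun d d' =>
    1 / 2 * (if d = d' then 1 else 0) +
      1 / 2 * (if d.snd = d'.fst ∧ d'.snd ≠ d.fst then ((r : ℝ) - 1)⁻¹ else 0)

def ad {n : ℕ} (G : SimpleGraph (Fin n)) (u v : Fin n) : ℝ := if G.Adj u v then 1 else 0

lemma ad_nonneg {n : ℕ} (G : SimpleGraph (Fin n)) (u v : Fin n) : 0 ≤ ad G u v := by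
  unfold ad; split_ifs <;> norm_num

lemma ad_symm {n : ℕ} (G : SimpleGraph (Fin n)) (u v : Fin n) : ad G u v = ad G v u := by
  unfold ad; simp [G.adj_comm]

lemma ad_one {n : ℕ} {G : SimpleGraph (Fin n)} {u v : Fin n} (h : G.Adj u v) : ad G u v = 1 := by
  simp [ad, h]

def nbr {n : ℕ} (G : SimpleGraph (Fin n)) (v : Fin n) : Finset (Fin n) :=
  Finset.univ.filter fun u => G.Adj v u

def isReg {n : ℕ} (r : ℕ) (G : SimpleGraph (Fin n)) : Prop := ∀ v, (nbr G v).card = r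

lemma mem_regSet_iff {r n : ℕ} (G : SimpleGraph (Fin n)) : G ∈ regSet r n ↔ isReg r G := by
  unfold regSet isReg nbr
  simp only [Finset.mem_filter, Finset.mem_univ, true_and]
  refine forall_congr' fun v => ?_
  rw [Nat.card_eq_fintype_card, ← Set.toFinset_card]
  have : (G.neighborSet v).toFinset = Finset.univ.filter fun u => G.Adj v u := by
    ext; simp
  rw [this]

lemma ad_sum {n r : ℕ} {G : SimpleGraph (Fin n)} (h : isReg r G) (v : Fin n) :
    ∑ u, ad G v u = r := by
  have := h v
  unfold ad
  rw [Finset.sum_ite, Finset.sum_const_zero, add_zero, Finset.sum_const, nsmul_eq_mul, mul_one]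
  exact_mod_cast this

lemma ad_sum' {n r : ℕ} {G : SimpleGraph (Fin n)} (h : isReg r G) (v : Fin n) :
    ∑ u, ad G u v = r := by
  rw [← ad_sum h v]; exact Finset.sum_congr rfl fun u _ => ad_symm _ _ _

def cutSet {n : ℕ} (G : SimpleGraph (Fin n)) (S : Finset (Fin n)) : Finset (Fin n × Fin n) :=
  (S ×ˢ Sᶜ).filter fun p => G.Adj p.1 p.2

lemma cut_card {n : ℕ} (G : SimpleGraph (Fin n)) (S : Finset (Fin n)) :
    ((cutSet G S).card : ℝ) = ∑ u, ∑ v, ad G u v * (if u ∈ S ∧ v ∉ S then 1 else 0) := by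
  rw [← Fintype.sum_prod_type' (f := fun u v => ad G u v * (if u ∈ S ∧ v ∉ S then (1:ℝ) else 0))]
  unfold cutSet
  rw [Finset.card_filter, Nat.cast_sum, ← Finset.sum_subset (Finset.subset_univ (S ×ˢ Sᶜ))]
  · refine Finset.sum_congr rfl fun p hp => ?_
    simp only [Finset.mem_product, Finset.mem_compl] at hp
    simp [hp, ad]
  · intro p _ hp
    simp only [Finset.mem_product, Finset.mem_compl] at hp
    simp [hp]

def expands {n : ℕ} (c : ℝ) (G : SimpleGraph (Fin n)) : Prop :=
  ∀ S : Finset (Fin n), 2 * S.card ≤ n → c * S.card ≤ (cutSet G S).card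

lemma coarea {n : ℕ} {c : ℝ} {G : SimpleGraph (Fin n)} (hx : expands c G) :
    ∀ m : ℕ, ∀ φ : Fin n → ℝ, (∀ v, 0 ≤ φ v) → (Finset.univ.filter fun v => φ v ≠ 0).card = m →
      2 * m ≤ n → c * ∑ v, φ v ≤ ∑ u, ∑ v, ad G u v * max (φ u - φ v) 0 := by
  intro m
  induction m using Nat.strong_induction_on with
  | _ m ih =>
  intro φ h0 hm hn
  set S := Finset.univ.filter fun v => φ v ≠ 0 with hS
  by_cases hne : S.Nonempty
  · obtain ⟨v0, hv0, hmin⟩ := Finset.exists_min_image S φ hne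
    set μ := φ v0 with hμ
    have hμ0 : 0 < μ := lt_of_le_of_ne (h0 v0) (by
      have := (Finset.mem_filter.mp hv0).2; exact this.symm)
    set ψ : Fin n → ℝ := fun v => φ v - if v ∈ S then μ else 0 with hψ
    have hnS : ∀ v, v ∉ S → φ v = 0 := by
      intro v hv; by_contra h; exact hv (by simp [hS, h])
    have hψ0 : ∀ v, 0 ≤ ψ v := by
      intro v; by_cases hv : v ∈ S
      · simp only [hψ, hv, if_true]; linarith [hmin v hv]
      · simp [hψ, hv, hnS v hv]
    have hss : (Finset.univ.filter fun v => ψ v ≠ 0) ⊂ S := by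
      refine (Finset.ssubset_iff_of_subset ?_).mpr ⟨v0, hv0, ?_⟩
      · intro v hv
        by_contra h
        simp [hψ, h, hnS v h] at hv
      · simp [hψ, hv0, hμ]
    have hlt := Finset.card_lt_card hss
    have key := ih _ (hm ▸ hlt) ψ hψ0 rfl (by omega)
    have hcut := hx S (by omega)
    have e1 : ∑ v, φ v = ∑ v, ψ v + μ * S.card := by
      simp only [hψ, Finset.sum_sub_distrib, Finset.sum_ite_mem, Finset.univ_inter,
        Finset.sum_const, nsmul_eq_mul]; ring
    have e2 : ∑ u, ∑ v, ad G u v * max (φ u - φ v) 0 =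
        ∑ u, ∑ v, ad G u v * max (ψ u - ψ v) 0 + μ * (cutSet G S).card := by
      rw [cut_card, Finset.mul_sum, ← Finset.sum_add_distrib]
      refine Finset.sum_congr rfl fun u _ => ?_
      rw [Finset.mul_sum, ← Finset.sum_add_distrib]
      refine Finset.sum_congr rfl fun v _ => ?_
      have : max (φ u - φ v) 0 = max (ψ u - ψ v) 0 + μ * (if u ∈ S ∧ v ∉ S then 1 else 0) := by
        have hu0 := hψ0 u
        have hv0 := hψ0 v
        by_cases hu : u ∈ S <;> by_cases hv : v ∈ S
        · simp [hψ, hu, hv]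
        · simp only [hψ, hu, hv, hnS v hv, if_true, if_false] at *
          simp only [sub_zero, not_false_eq_true, and_self, if_true, mul_one]
          rw [max_eq_left (h0 u), max_eq_left hu0]; ring
        · simp only [hψ, hu, hv, hnS u hu, if_true, if_false] at *
          have := h0 v
          rw [max_eq_right (by linarith), max_eq_right (by linarith)]; simp
        · simp [hψ, hu, hv]
      rw [this]; ring
    rw [e1, e2]
    have := mul_le_mul_of_nonneg_left hcut hμ0.le
    nlinarith
  · have : ∀ v, φ v = 0 := by
      intro v; by_contra h; exact hne ⟨v, by simp [hS, h]⟩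
    simp [this]

def energy {n : ℕ} (G : SimpleGraph (Fin n)) (f : Fin n → ℝ) : ℝ :=
  ∑ u, ∑ v, ad G u v * (f u - f v) ^ 2

lemma half_poincare {n r : ℕ} {c : ℝ} {G : SimpleGraph (Fin n)} (hc : 0 < c) (hr : 0 < r)
    (hreg : isReg r G) (hx : expands c G) (f : Fin n → ℝ) (h0 : ∀ v, 0 ≤ f v)
    (hs : 2 * (Finset.univ.filter fun v => 0 < f v).card ≤ n) :
    ∑ v, f v ^ 2 ≤ 4 * r / c ^ 2 * energy G f := by
  have hr' : (0:ℝ) < r := by exact_mod_cast hr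
  have h1 := coarea hx _ (fun v => f v ^ 2) (fun v => sq_nonneg _) rfl (by
    refine le_trans ?_ hs
    gcongr with v
    intro hv
    exact lt_of_le_of_ne (h0 v) (fun h => hv (by simp [← h])))
  have h2 : ∑ u, ∑ v, ad G u v * max (f u ^ 2 - f v ^ 2) 0 ≤
      ∑ u, ∑ v, (2 * r / c * (ad G u v * (f u - f v) ^ 2) + c / (4 * r) * (ad G u v * f u ^ 2) +
        c / (4 * r) * (ad G u v * f v ^ 2)) := by
    refine Finset.sum_le_sum fun u _ => Finset.sum_le_sum fun v _ => ?_
    have : max (f u ^ 2 - f v ^ 2) 0 ≤ 2 * r / c * (f u - f v) ^ 2 + c / (4 * r) * f u ^ 2 +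
        c / (4 * r) * f v ^ 2 := by
      refine max_le ?_ (by positivity)
      set t := c / (4 * r) with ht
      have htp : 0 < t := by positivity
      have : 2 * r / c = 1 / (2 * t) := by rw [ht]; field_simp; norm_num
      rw [this]
      have h3 : 1 / (2 * t) * (f u - f v) ^ 2 + t * f u ^ 2 + t * f v ^ 2 - (f u ^ 2 - f v ^ 2)
        = 1 / (2 * t) * ((f u - f v) - t * (f u + f v)) ^ 2 + t / 2 * (f u - f v) ^ 2 := by
        field_simp; ring
      have : 0 ≤ 1 / (2 * t) * ((f u - f v) - t * (f u + f v)) ^ 2 + t / 2 * (f u - f v) ^ 2 := by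
        positivity
      linarith
    nlinarith [mul_le_mul_of_nonneg_left this (ad_nonneg G u v)]
  have h3 : ∑ u, ∑ v, ad G u v * f u ^ 2 = r * ∑ v, f v ^ 2 := by
    simp_rw [← Finset.sum_mul, ad_sum hreg, ← Finset.mul_sum]
  have h4 : ∑ u, ∑ v, ad G u v * f v ^ 2 = r * ∑ v, f v ^ 2 := by
    rw [Finset.sum_comm]
    simp_rw [← Finset.sum_mul, ad_sum' hreg, ← Finset.mul_sum]
  simp_rw [Finset.sum_add_distrib, ← Finset.mul_sum] at h2
  rw [h3, h4] at h2
  have h5 := h1.trans h2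
  have h6 : c / (4 * r) * (r * ∑ v, f v ^ 2) = c / 4 * ∑ v, f v ^ 2 := by field_simp
  rw [h6] at h5
  change _ ≤ 2 * r / c * energy G f + _ + _ at h5
  have h7 : c / 2 * ∑ v, f v ^ 2 ≤ 2 * r / c * energy G f := by linarith
  have h8 : ∑ v, f v ^ 2 = 2 / c * (c / 2 * ∑ v, f v ^ 2) := by field_simp
  rw [h8]
  calc _ ≤ 2 / c * (2 * r / c * energy G f) := by gcongr
    _ = _ := by field_simp; ring

lemma exists_median {n : ℕ} (hn : 0 < n) (h : Fin n → ℝ) : ∃ m : ℝ,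
    2 * (Finset.univ.filter fun v => m < h v).card ≤ n ∧
    2 * (Finset.univ.filter fun v => h v < m).card ≤ n := by
  set T := Finset.univ.filter fun v => n ≤ 2 * (Finset.univ.filter fun u => h u ≤ h v).card with hT
  have : Nonempty (Fin n) := ⟨⟨0, hn⟩⟩
  have hTne : T.Nonempty := by
    obtain ⟨v, hv⟩ := Finite.exists_max h
    refine ⟨v, ?_⟩
    simp [hT, hv]; omega
  obtain ⟨v0, hv0, hmin⟩ := Finset.exists_min_image T h hTne
  refine ⟨h v0, ?_, ?_⟩
  · have h1 := (Finset.mem_filter.mp hv0).2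
    have h2 := Finset.card_filter_add_card_filter_not (s := (Finset.univ : Finset (Fin n))) (fun u => h u ≤ h v0)
    simp only [not_le, Finset.card_univ, Fintype.card_fin] at h2
    omega
  · by_contra hcon
    push Not at hcon
    have hne : (Finset.univ.filter fun v => h v < h v0).Nonempty := by
      rw [← Finset.card_pos]; omega
    obtain ⟨v1, hv1, hmax⟩ := Finset.exists_max_image _ h hne
    have h1 : v1 ∈ T := by
      simp only [hT, Finset.mem_filter, Finset.mem_univ, true_and]
      refine hcon.le.trans ?_
      gcongr with u
      intro hu
      exact hmax u (by simp [hu])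
    have := hmin v1 h1
    have h3 := (Finset.mem_filter.mp hv1).2
    linarith

lemma poincare {n r : ℕ} {c : ℝ} {G : SimpleGraph (Fin n)} (hc : 0 < c) (hr : 0 < r) (hn : 0 < n)
    (hreg : isReg r G) (hx : expands c G) (h : Fin n → ℝ) (h0 : ∑ v, h v = 0) :
    ∑ v, h v ^ 2 ≤ 4 * r / c ^ 2 * energy G h := by
  obtain ⟨m, hm1, hm2⟩ := exists_median hn h
  have hp := half_poincare hc hr hreg hx (fun v => max (h v - m) 0) (fun v => le_max_right _ _) (by
    simpa using hm1)
  have hq := half_poincare hc hr hreg hx (fun v => max (m - h v) 0) (fun v => le_max_right _ _) (by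
    simpa using hm2)
  have e1 : ∑ v, h v ^ 2 ≤ ∑ v, (h v - m) ^ 2 := by
    have : ∀ v, (h v - m) ^ 2 = h v ^ 2 - 2 * m * h v + m ^ 2 := fun v => by ring
    simp_rw [this, Finset.sum_add_distrib, Finset.sum_sub_distrib, ← Finset.mul_sum, h0]
    simp; positivity
  have e2 : ∑ v, (h v - m) ^ 2 = ∑ v, max (h v - m) 0 ^ 2 + ∑ v, max (m - h v) 0 ^ 2 := by
    rw [← Finset.sum_add_distrib]
    refine Finset.sum_congr rfl fun v _ => ?_
    rcases le_total (h v) m with h1 | h1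
    · rw [max_eq_right (by linarith), max_eq_left (by linarith)]; ring
    · rw [max_eq_left (by linarith), max_eq_right (by linarith)]; ring
  have e3 : energy G (fun v => max (h v - m) 0) + energy G (fun v => max (m - h v) 0) ≤ energy G h := by
    unfold energy
    rw [← Finset.sum_add_distrib]
    refine Finset.sum_le_sum fun u _ => ?_
    rw [← Finset.sum_add_distrib]
    refine Finset.sum_le_sum fun v _ => ?_
    rw [← mul_add]
    refine mul_le_mul_of_nonneg_left ?_ (ad_nonneg _ _ _)
    dsimp only
    rcases le_total (h v) m with h1 | h1 <;> rcases le_total (h u) m with h2 | h2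
    · rw [max_eq_right (sub_nonpos.2 h2), max_eq_right (sub_nonpos.2 h1),
        max_eq_left (sub_nonneg.2 h2), max_eq_left (sub_nonneg.2 h1)]; nlinarith
    · rw [max_eq_left (sub_nonneg.2 h2), max_eq_right (sub_nonpos.2 h1),
        max_eq_right (sub_nonpos.2 h2), max_eq_left (sub_nonneg.2 h1)]; nlinarith
    · rw [max_eq_right (sub_nonpos.2 h2), max_eq_left (sub_nonneg.2 h1),
        max_eq_left (sub_nonneg.2 h2), max_eq_right (sub_nonpos.2 h1)]; nlinarith
    · rw [max_eq_left (sub_nonneg.2 h2), max_eq_left (sub_nonneg.2 h1),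
        max_eq_right (sub_nonpos.2 h2), max_eq_right (sub_nonpos.2 h1)]; nlinarith
  calc _ ≤ _ := e1
    _ = _ := e2
    _ ≤ 4 * r / c ^ 2 * energy G (fun v => max (h v - m) 0) + 4 * r / c ^ 2 * energy G (fun v => max (m - h v) 0) := add_le_add hp hq
    _ = 4 * r / c ^ 2 * (energy G (fun v => max (h v - m) 0) + energy G (fun v => max (m - h v) 0)) := by ring
    _ ≤ _ := by gcongr

/-- local Dirichlet form at `v` -/
def dloc {n : ℕ} (G : SimpleGraph (Fin n)) (g : Fin n → Fin n → ℝ) (v : Fin n) : ℝ :=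
  ∑ u, ∑ w, ad G u v * ad G v w * (if w ≠ u then 1 else 0) * (g u v - g v w) ^ 2

lemma dloc_ge {n : ℕ} (G : SimpleGraph (Fin n)) (g : Fin n → Fin n → ℝ) (u v w : Fin n)
    (h1 : G.Adj u v) (h2 : G.Adj v w) (h3 : w ≠ u) : (g u v - g v w) ^ 2 ≤ dloc G g v := by
  have hnn : ∀ u w, 0 ≤ ad G u v * ad G v w * (if w ≠ u then (1:ℝ) else 0) * (g u v - g v w) ^ 2 := by
    intro u w
    have := ad_nonneg G u v
    have := ad_nonneg G v w
    split_ifs <;> positivity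
  calc (g u v - g v w) ^ 2 = ad G u v * ad G v w * (if w ≠ u then 1 else 0) * (g u v - g v w) ^ 2 := by
        simp [ad_one h1, ad_one h2, h3]
    _ ≤ ∑ w, ad G u v * ad G v w * (if w ≠ u then 1 else 0) * (g u v - g v w) ^ 2 :=
        Finset.single_le_sum (f := fun w => ad G u v * ad G v w * (if w ≠ u then (1:ℝ) else 0) * (g u v - g v w) ^ 2)
          (fun w _ => hnn u w) (Finset.mem_univ w)
    _ ≤ _ := Finset.single_le_sum (f := fun u => ∑ w, ad G u v * ad G v w * (if w ≠ u then (1:ℝ) else 0) * (g u v - g v w) ^ 2)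
          (fun u _ => Finset.sum_nonneg fun w _ => hnn u w) (Finset.mem_univ u)

lemma third {n r : ℕ} {G : SimpleGraph (Fin n)} (hr : 3 ≤ r) (hreg : isReg r G) (v a b : Fin n) :
    ∃ w, G.Adj v w ∧ w ≠ a ∧ w ≠ b := by
  have h1 : ({a, b} : Finset (Fin n)).card < (nbr G v).card := by
    rw [hreg v]; exact lt_of_le_of_lt Finset.card_le_two (by omega)
  obtain ⟨w, hw, hw'⟩ := Finset.exists_mem_notMem_of_card_lt_card h1
  simp only [Finset.mem_insert, Finset.mem_singleton, not_or] at hw'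
  exact ⟨w, (Finset.mem_filter.mp hw).2, hw'.1, hw'.2⟩

lemma in_in {n r : ℕ} {G : SimpleGraph (Fin n)} (hr : 3 ≤ r) (hreg : isReg r G)
    (g : Fin n → Fin n → ℝ) (u u' v : Fin n) (h1 : G.Adj u v) (h2 : G.Adj u' v) :
    (g u v - g u' v) ^ 2 ≤ 4 * dloc G g v := by
  obtain ⟨w, hw, ha, hb⟩ := third hr hreg v u u'
  have e1 := dloc_ge G g u v w h1 hw ha
  have e2 := dloc_ge G g u' v w h2 hw hb
  nlinarith [sq_nonneg ((g u v - g v w) + (g u' v - g v w))]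

lemma in_out {n r : ℕ} {G : SimpleGraph (Fin n)} (hr : 3 ≤ r) (hreg : isReg r G)
    (g : Fin n → Fin n → ℝ) (u v w : Fin n) (h1 : G.Adj u v) (h2 : G.Adj v w) :
    (g u v - g v w) ^ 2 ≤ 10 * dloc G g v := by
  obtain ⟨u', hu, ha, hb⟩ := third hr hreg v w w
  have e1 := in_in hr hreg g u u' v h1 hu.symm
  have e2 := dloc_ge G g u' v w hu.symm h2 ha.symm
  nlinarith [sq_nonneg ((g u v - g u' v) - (g u' v - g v w))]

lemma avg_bound {n r : ℕ} {G : SimpleGraph (Fin n)} (hreg : isReg r G)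
    (g : Fin n → Fin n → ℝ) (v : Fin n) (x M : ℝ) (hM : ∀ u, G.Adj u v → (g u v - x) ^ 2 ≤ M) :
    (∑ u, ad G u v * g u v - r * x) ^ 2 ≤ r ^ 2 * M := by
  have e : ∑ u, ad G u v * g u v - r * x = ∑ u, ad G u v * (ad G u v * (g u v - x)) := by
    rw [← ad_sum' hreg v, Finset.sum_mul, ← Finset.sum_sub_distrib]
    refine Finset.sum_congr rfl fun u _ => ?_
    unfold ad; split_ifs <;> simp
  rw [e]
  refine (Finset.sum_mul_sq_le_sq_mul_sq _ _ _).trans ?_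
  have e1 : ∑ u, ad G u v ^ 2 = r := by
    rw [← ad_sum' hreg v]
    refine Finset.sum_congr rfl fun u _ => ?_
    unfold ad; split_ifs <;> simp
  have e2 : ∑ u, (ad G u v * (g u v - x)) ^ 2 ≤ ∑ u, ad G u v * M := by
    refine Finset.sum_le_sum fun u _ => ?_
    by_cases h : G.Adj u v
    · simp [ad, h, hM u h]
    · simp [ad, h]
  rw [← Finset.sum_mul, ad_sum' hreg v] at e2
  rw [e1]
  calc _ ≤ (r:ℝ) * (r * M) := by gcongr
    _ = _ := by ring

lemma dart_poincare {n r : ℕ} {c : ℝ} {G : SimpleGraph (Fin n)} (hc : 0 < c) (hr : 3 ≤ r) (hn : 0 < n)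
    (hreg : isReg r G) (hx : expands c G) (g : Fin n → Fin n → ℝ)
    (h0 : ∑ u, ∑ v, ad G u v * g u v = 0) :
    ∑ u, ∑ v, ad G u v * g u v ^ 2 ≤
      (8 * r + 8 / r * (28 * r ^ 4 / c ^ 2)) * ∑ v, dloc G g v := by
  have hr' : (0:ℝ) < r := by
    have : 0 < r := by omega
    exact_mod_cast this
  set h : Fin n → ℝ := fun v => ∑ u, ad G u v * g u v with hh
  have hs : ∑ v, h v = 0 := by rw [← h0, hh, Finset.sum_comm]
  have hP := poincare hc (by omega) hn hreg hx h hs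
  have hin : ∀ u v, G.Adj u v → (h v - r * g u v) ^ 2 ≤ r ^ 2 * (4 * dloc G g v) := fun u v huv =>
    avg_bound hreg g v _ _ fun u' h' => in_in hr hreg g u' u v h' huv
  have hout : ∀ u v, G.Adj u v → (h u - r * g u v) ^ 2 ≤ r ^ 2 * (10 * dloc G g u) := fun u v huv =>
    avg_bound hreg g u _ _ fun u' h' => in_out hr hreg g u' u v h' huv
  have hE : energy G h ≤ 28 * r ^ 3 * ∑ v, dloc G g v := by
    unfold energy
    calc _ ≤ ∑ u, ∑ v, (ad G u v * (20 * r ^ 2 * dloc G g u) + ad G u v * (8 * r ^ 2 * dloc G g v)) := by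
          refine Finset.sum_le_sum fun u _ => Finset.sum_le_sum fun v _ => ?_
          by_cases huv : G.Adj u v
          · have := hin u v huv
            have := hout u v huv
            simp only [ad_one huv, one_mul]
            nlinarith [sq_nonneg ((h u - r * g u v) + (h v - r * g u v))]
          · simp [ad, huv]
      _ = _ := by
          simp_rw [Finset.sum_add_distrib]
          rw [Finset.sum_comm (f := fun u v => ad G u v * (8 * r ^ 2 * dloc G g v))]
          simp_rw [← Finset.sum_mul, ad_sum hreg, ad_sum' hreg, ← Finset.mul_sum]
          ring
  have hfin : r ^ 2 * ∑ u, ∑ v, ad G u v * g u v ^ 2 ≤ 2 * r * ∑ v, h v ^ 2 + 8 * r ^ 3 * ∑ v, dloc G g v := by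
    calc _ ≤ ∑ u, ∑ v, (ad G u v * (2 * h v ^ 2 + 8 * r ^ 2 * dloc G g v)) := by
          rw [Finset.mul_sum]
          refine Finset.sum_le_sum fun u _ => ?_
          rw [Finset.mul_sum]
          refine Finset.sum_le_sum fun v _ => ?_
          by_cases huv : G.Adj u v
          · have := hin u v huv
            simp only [ad_one huv, one_mul]
            nlinarith [sq_nonneg (h v + (h v - r * g u v))]
          · simp [ad, huv]
      _ = _ := by
          rw [Finset.sum_comm]
          simp_rw [← Finset.sum_mul, ad_sum' hreg, ← Finset.mul_sum, Finset.sum_add_distrib, ← Finset.mul_sum]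
          ring
  have h1 : ∑ v, h v ^ 2 ≤ 4 * r / c ^ 2 * (28 * r ^ 3 * ∑ v, dloc G g v) :=
    hP.trans (by gcongr)
  have h2 : r ^ 2 * ∑ u, ∑ v, ad G u v * g u v ^ 2 ≤
      r ^ 2 * ((8 * r + 8 / r * (28 * r ^ 4 / c ^ 2)) * ∑ v, dloc G g v) := by
    refine hfin.trans ?_
    calc _ ≤ 2 * r * (4 * r / c ^ 2 * (28 * r ^ 3 * ∑ v, dloc G g v)) + 8 * r ^ 3 * ∑ v, dloc G g v := by gcongr
      _ = _ := by field_simp; ring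
  exact le_of_mul_le_mul_left h2 (by positivity)

lemma sum_dart {n : ℕ} (G : SimpleGraph (Fin n)) (F : Fin n → Fin n → ℝ) :
    ∑ d : G.Dart, F d.fst d.snd = ∑ u, ∑ v, ad G u v * F u v := by
  rw [← Fintype.sum_prod_type' (f := fun u v => ad G u v * F u v)]
  have : ∀ p : Fin n × Fin n, ad G p.1 p.2 * F p.1 p.2 = if G.Adj p.1 p.2 then F p.1 p.2 else 0 := by
    intro p; unfold ad; split_ifs <;> simp
  simp_rw [this]
  rw [← Finset.sum_filter]
  refine Finset.sum_bij (fun d _ => d.toProd) ?_ ?_ ?_ ?_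
  · intro d _; simp [d.adj]
  · intro a _ b _ h; exact SimpleGraph.Dart.ext _ _ h
  · intro p hp
    exact ⟨⟨p, (Finset.mem_filter.mp hp).2⟩, Finset.mem_univ _, rfl⟩
  · intro d _; rfl

def nbN {n : ℕ} (r : ℕ) (G : SimpleGraph (Fin n)) (d d' : G.Dart) : ℝ :=
  if d.snd = d'.fst ∧ d'.snd ≠ d.fst then ((r : ℝ) - 1)⁻¹ else 0

lemma sum_ne {n r : ℕ} {G : SimpleGraph (Fin n)} (hreg : isReg r G) {v a : Fin n} (h : G.Adj v a) :
    ∑ w, ad G v w * (if w ≠ a then ((r : ℝ) - 1)⁻¹ else 0) = (r - 1) * ((r : ℝ) - 1)⁻¹ := by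
  have : ∀ w, ad G v w * (if w ≠ a then ((r : ℝ) - 1)⁻¹ else 0) =
      ad G v w * ((r : ℝ) - 1)⁻¹ - (if w = a then ad G v a * ((r : ℝ) - 1)⁻¹ else 0) := by
    intro w
    by_cases hw : w = a
    · simp [hw]
    · simp [hw]
  simp_rw [this, Finset.sum_sub_distrib, ← Finset.sum_mul, ad_sum hreg]
  simp [ad_one h]; ring

lemma row_sum {n r : ℕ} {G : SimpleGraph (Fin n)} (hr : 3 ≤ r) (hreg : isReg r G) (d : G.Dart) :
    ∑ d', nbN r G d d' = 1 := by
  unfold nbN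
  rw [sum_dart G (fun a b => if d.snd = a ∧ b ≠ d.fst then ((r : ℝ) - 1)⁻¹ else 0)]
  rw [Finset.sum_eq_single d.snd]
  · simp only [true_and]
    rw [sum_ne hreg d.adj.symm]
    have : (3:ℝ) ≤ r := by exact_mod_cast hr
    exact mul_inv_cancel₀ (by linarith)
  · intro b _ hb; simp [hb.symm]
  · simp

lemma col_sum {n r : ℕ} {G : SimpleGraph (Fin n)} (hr : 3 ≤ r) (hreg : isReg r G) (d' : G.Dart) :
    ∑ d, nbN r G d d' = 1 := by
  unfold nbN
  rw [sum_dart G (fun a b => if b = d'.fst ∧ d'.snd ≠ a then ((r : ℝ) - 1)⁻¹ else 0), Finset.sum_comm]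
  rw [Finset.sum_eq_single d'.fst]
  · simp only [true_and]
    have := sum_ne hreg d'.adj
    simp_rw [ad_symm G _ d'.fst, ne_comm (a := d'.snd)]
    rw [this]
    have : (3:ℝ) ≤ r := by exact_mod_cast hr
    exact mul_inv_cancel₀ (by linarith)
  · intro b _ hb; simp [hb]
  · simp

lemma dirichlet_eq {n r : ℕ} {G : SimpleGraph (Fin n)} (g : Fin n → Fin n → ℝ) :
    ∑ d, ∑ d', nbN r G d d' * (g d.fst d.snd - g d'.fst d'.snd) ^ 2 =
      ((r : ℝ) - 1)⁻¹ * ∑ v, dloc G g v := by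
  unfold nbN
  have h1 : ∀ d : G.Dart, ∑ d' : G.Dart, (if d.snd = d'.fst ∧ d'.snd ≠ d.fst then ((r : ℝ) - 1)⁻¹ else 0)
      * (g d.fst d.snd - g d'.fst d'.snd) ^ 2 =
      ∑ w, ad G d.snd w * ((if w ≠ d.fst then ((r : ℝ) - 1)⁻¹ else 0) * (g d.fst d.snd - g d.snd w) ^ 2) := by
    intro d
    rw [sum_dart G (fun a b => (if d.snd = a ∧ b ≠ d.fst then ((r : ℝ) - 1)⁻¹ else 0)
      * (g d.fst d.snd - g a b) ^ 2)]
    rw [Finset.sum_eq_single d.snd]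
    · simp only [true_and]
    · intro b _ hb; simp [hb.symm]
    · simp
  simp_rw [h1]
  rw [sum_dart G (fun a b => ∑ w, ad G b w * ((if w ≠ a then ((r : ℝ) - 1)⁻¹ else 0) * (g a b - g b w) ^ 2)),
    Finset.sum_comm, Finset.mul_sum]
  refine Finset.sum_congr rfl fun v _ => ?_
  unfold dloc
  rw [Finset.mul_sum]
  refine Finset.sum_congr rfl fun u _ => ?_
  rw [Finset.mul_sum, Finset.mul_sum]
  refine Finset.sum_congr rfl fun w _ => ?_
  split_ifs <;> ring

lemma nbLazy_apply {n r : ℕ} {G : SimpleGraph (Fin n)} (hr : 3 ≤ r) (hreg : isReg r G)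
    (g : G.Dart → ℝ) (d : G.Dart) :
    (nbLazy r G).mulVec g d = ∑ d', nbN r G d d' * ((g d + g d') / 2) := by
  have : ∀ d', nbN r G d d' * ((g d + g d') / 2) = nbN r G d d' * (g d / 2) + 1 / 2 * (nbN r G d d' * g d') := by
    intro d'; ring
  simp_rw [this, Finset.sum_add_distrib, ← Finset.sum_mul, row_sum hr hreg]
  unfold Matrix.mulVec dotProduct nbLazy
  simp only [Matrix.of_apply, add_mul, Finset.sum_add_distrib]
  congr 1
  · simp [mul_comm]; ring
  · rw [← Finset.mul_sum]
    simp only [mul_assoc, ← Finset.mul_sum]; rfl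

lemma nbLazy_sum {n r : ℕ} {G : SimpleGraph (Fin n)} (hr : 3 ≤ r) (hreg : isReg r G)
    (g : G.Dart → ℝ) : ∑ d, (nbLazy r G).mulVec g d = ∑ d, g d := by
  simp_rw [nbLazy_apply hr hreg]
  have : ∀ d d', nbN r G d d' * ((g d + g d') / 2) = nbN r G d d' * (g d / 2) + nbN r G d d' * (g d' / 2) := by
    intro d d'; ring
  simp_rw [this, Finset.sum_add_distrib]
  rw [Finset.sum_comm (f := fun d d' => nbN r G d d' * (g d' / 2))]
  simp_rw [← Finset.sum_mul, row_sum hr hreg, col_sum hr hreg, one_mul, ← Finset.sum_add_distrib]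
  refine Finset.sum_congr rfl fun d _ => by ring

lemma nbN_nonneg {n r : ℕ} {G : SimpleGraph (Fin n)} (hr : 3 ≤ r) (d d' : G.Dart) : 0 ≤ nbN r G d d' := by
  have : (3:ℝ) ≤ r := by exact_mod_cast hr
  unfold nbN; split_ifs
  · exact inv_nonneg.2 (by linarith)
  · exact le_rfl

lemma jensen_sq {ι : Type*} [Fintype ι] (p x : ι → ℝ) (hp : ∀ i, 0 ≤ p i) (h1 : ∑ i, p i = 1) :
    (∑ i, p i * x i) ^ 2 ≤ ∑ i, p i * x i ^ 2 := by
  have h := Finset.sum_sq_le_sum_mul_sum_of_sq_le_mul Finset.univ (r := fun i => p i * x i)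
    (f := p) (g := fun i => p i * x i ^ 2) (fun i _ => hp i) (fun i _ => by have := hp i; positivity)
    (fun i _ => le_of_eq (by ring))
  rwa [h1, one_mul] at h

lemma nbLazy_energy {n r : ℕ} {G : SimpleGraph (Fin n)} (hr : 3 ≤ r) (hreg : isReg r G)
    (g : G.Dart → ℝ) : ∑ d, (nbLazy r G).mulVec g d ^ 2 ≤
      ∑ d, g d ^ 2 - 1 / 4 * ∑ d, ∑ d', nbN r G d d' * (g d - g d') ^ 2 := by
  have h1 : ∑ d, (nbLazy r G).mulVec g d ^ 2 ≤ ∑ d, ∑ d', nbN r G d d' * ((g d + g d') / 2) ^ 2 := by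
    refine Finset.sum_le_sum fun d _ => ?_
    rw [nbLazy_apply hr hreg]
    exact jensen_sq _ _ (nbN_nonneg hr d) (row_sum hr hreg d)
  refine h1.trans (le_of_eq ?_)
  have : ∀ d d', nbN r G d d' * ((g d + g d') / 2) ^ 2 = nbN r G d d' * (g d ^ 2 / 2) +
    nbN r G d d' * (g d' ^ 2 / 2) - 1 / 4 * (nbN r G d d' * (g d - g d') ^ 2) := by
    intro d d'; ring
  simp_rw [this, Finset.sum_sub_distrib, Finset.sum_add_distrib]
  rw [Finset.sum_comm (f := fun d d' => nbN r G d d' * (g d' ^ 2 / 2))]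
  simp_rw [← Finset.sum_mul, row_sum hr hreg, col_sum hr hreg, one_mul, ← Finset.mul_sum]
  rw [← Finset.sum_add_distrib]
  congr 1
  refine Finset.sum_congr rfl fun d _ => by ring

def KK (r : ℕ) (c : ℝ) : ℝ := 8 * r + 8 / r * (28 * r ^ 4 / c ^ 2)

def gam (r : ℕ) (c : ℝ) : ℝ := 1 / 4 * ((r : ℝ) - 1)⁻¹ / KK r c

lemma KK_pos {r : ℕ} {c : ℝ} (hr : 3 ≤ r) (hc : 0 < c) : 0 < KK r c := by
  have : (3:ℝ) ≤ r := by exact_mod_cast hr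
  unfold KK; positivity

lemma gam_pos {r : ℕ} {c : ℝ} (hr : 3 ≤ r) (hc : 0 < c) : 0 < gam r c := by
  have : (3:ℝ) ≤ r := by exact_mod_cast hr
  have h1 : (0:ℝ) < r - 1 := by linarith
  have := KK_pos hr hc
  unfold gam; positivity

lemma contraction {n r : ℕ} {c : ℝ} {G : SimpleGraph (Fin n)} (hc : 0 < c) (hr : 3 ≤ r) (hn : 0 < n)
    (hreg : isReg r G) (hx : expands c G) (g : G.Dart → ℝ) (h0 : ∑ d, g d = 0) :
    ∑ d, (nbLazy r G).mulVec g d ^ 2 ≤ (1 - gam r c) * ∑ d, g d ^ 2 := by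
  set gg : Fin n → Fin n → ℝ := fun u v => if h : G.Adj u v then g ⟨(u, v), h⟩ else 0 with hgg
  have hg : ∀ d : G.Dart, g d = gg d.fst d.snd := by
    intro d; simp only [hgg]; rw [dif_pos d.adj]
  have h1 := nbLazy_energy hr hreg g
  have h2 : ∑ d, ∑ d', nbN r G d d' * (g d - g d') ^ 2 = ((r : ℝ) - 1)⁻¹ * ∑ v, dloc G gg v := by
    rw [← dirichlet_eq]; simp_rw [hg]
  have h3 := dart_poincare hc hr hn hreg hx gg (by rw [← sum_dart, ← h0]; simp_rw [hg])
  have h4 : ∑ u, ∑ v, ad G u v * gg u v ^ 2 = ∑ d, g d ^ 2 := by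
    rw [← sum_dart G (fun u v => gg u v ^ 2)]; simp_rw [hg]
  rw [h4] at h3
  change _ ≤ KK r c * _ at h3
  have hK := KK_pos hr hc
  have h5 : gam r c * ∑ d, g d ^ 2 ≤ 1 / 4 * (((r : ℝ) - 1)⁻¹ * ∑ v, dloc G gg v) := by
    calc _ ≤ gam r c * (KK r c * ∑ v, dloc G gg v) := by
          have := (gam_pos hr hc).le
          gcongr
      _ = _ := by unfold gam; field_simp
  rw [h2] at h1
  linarith

lemma contraction_pow {n r : ℕ} {c : ℝ} {G : SimpleGraph (Fin n)} (hc : 0 < c) (hr : 3 ≤ r) (hn : 0 < n)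
    (hreg : isReg r G) (hx : expands c G) (g : G.Dart → ℝ) (h0 : ∑ d, g d = 0) (t : ℕ) :
    ∑ d, ((nbLazy r G) ^ t).mulVec g d = 0 ∧
    ∑ d, ((nbLazy r G) ^ t).mulVec g d ^ 2 ≤ Real.exp (-gam r c * t) * ∑ d, g d ^ 2 := by
  induction t with
  | zero => simp [h0]
  | succ t ih =>
    have e : (nbLazy r G) ^ (t + 1) = nbLazy r G * (nbLazy r G) ^ t := pow_succ' _ _
    rw [e, ← Matrix.mulVec_mulVec]
    refine ⟨by rw [nbLazy_sum hr hreg, ih.1], ?_⟩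
    refine (contraction hc hr hn hreg hx _ ih.1).trans ?_
    have h1 : 1 - gam r c ≤ Real.exp (-gam r c) := by
      have := Real.add_one_le_exp (-gam r c); linarith
    calc _ ≤ Real.exp (-gam r c) * (Real.exp (-gam r c * t) * ∑ d, g d ^ 2) := by
          refine mul_le_mul h1 ih.2 (Finset.sum_nonneg fun _ _ => sq_nonneg _) (Real.exp_pos _).le
      _ = _ := by
          rw [← mul_assoc, ← Real.exp_add]; push_cast; ring_nf

lemma card_dart {n r : ℕ} {G : SimpleGraph (Fin n)} (hreg : isReg r G) :
    (Fintype.card G.Dart : ℝ) = r * n := by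
  have := sum_dart G (fun _ _ => 1)
  simp only [mul_one, ad_sum hreg] at this
  simp at this
  rw [mul_comm]; exact_mod_cast this

lemma mixing {n r : ℕ} {c : ℝ} {G : SimpleGraph (Fin n)} (hc : 0 < c) (hr : 3 ≤ r) (hn : 0 < n)
    (hreg : isReg r G) (hx : expands c G) (t : ℕ) (ht : 8 / gam r c * Real.log n ≤ t) (e f : G.Dart) :
    |((nbLazy r G) ^ t) e f - ((r : ℝ) * n)⁻¹| ≤ (((n : ℝ)) ^ 4)⁻¹ := by
  have hn' : (0:ℝ) < n := by exact_mod_cast hn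
  have hr' : (3:ℝ) ≤ r := by exact_mod_cast hr
  have hcard := card_dart hreg
  have hpos : (0:ℝ) < r * n := by positivity
  set one : G.Dart → ℝ := fun _ => ((r:ℝ) * n)⁻¹ with hone
  set g : G.Dart → ℝ := Pi.single f 1 - one with hg
  have hrow : ∀ t : ℕ, ((nbLazy r G) ^ t).mulVec one = one := by
    intro t
    induction t with
    | zero => simp
    | succ t ih =>
      rw [pow_succ, ← Matrix.mulVec_mulVec]
      have : (nbLazy r G).mulVec one = one := by
        funext d
        rw [nbLazy_apply hr hreg]
        simp only [hone, add_self_div_two, ← Finset.sum_mul, row_sum hr hreg, one_mul]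
      rw [this, ih]
  have hs : ∑ d, g d = 0 := by
    simp only [hg, Pi.sub_apply, Finset.sum_sub_distrib, hone]
    simp only [Finset.sum_pi_single', Finset.mem_univ, if_true, Finset.sum_const, Finset.card_univ, nsmul_eq_mul]
    rw [hcard, mul_inv_cancel₀ hpos.ne', sub_self]
  have hn2 : ∑ d, g d ^ 2 ≤ 1 := by
    have : ∀ d, g d ^ 2 = g d * (Pi.single f 1 : G.Dart → ℝ) d - ((r:ℝ) * n)⁻¹ * g d := by
      intro d; simp only [hg, hone, Pi.sub_apply]; ring
    simp_rw [this, Finset.sum_sub_distrib, ← Finset.mul_sum, hs]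
    rw [Finset.sum_eq_single f]
    · simp [hg, hone]; positivity
    · intro b _ hb; simp [hb]
    · simp
  have hval : ((nbLazy r G) ^ t).mulVec g e = ((nbLazy r G) ^ t) e f - ((r : ℝ) * n)⁻¹ := by
    rw [hg, Matrix.mulVec_sub, hrow]
    simp [hone]
  rw [← hval]
  have hp := (contraction_pow hc hr hn hreg hx g hs t).2
  have h1 : ((nbLazy r G) ^ t).mulVec g e ^ 2 ≤ Real.exp (-gam r c * t) := by
    calc _ ≤ ∑ d, ((nbLazy r G) ^ t).mulVec g d ^ 2 :=
          Finset.single_le_sum (f := fun d => ((nbLazy r G) ^ t).mulVec g d ^ 2) (fun _ _ => sq_nonneg _) (Finset.mem_univ e)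
      _ ≤ _ := hp
      _ ≤ Real.exp (-gam r c * t) * 1 := by gcongr
      _ = _ := mul_one _
  have hgp := gam_pos hr hc
  have h2 : Real.exp (-gam r c * t) ≤ ((((n : ℝ)) ^ 4)⁻¹) ^ 2 := by
    have : (((n : ℝ) ^ 4)⁻¹) ^ 2 = Real.exp (-(8 * Real.log n)) := by
      rw [Real.exp_neg, mul_comm, Real.exp_mul, Real.exp_log hn']
      rw [← inv_pow, ← pow_mul, inv_pow]
      norm_cast
    rw [this]
    apply Real.exp_le_exp.2
    have : gam r c * (8 / gam r c * Real.log n) ≤ gam r c * t := by gcongr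
    have e : gam r c * (8 / gam r c * Real.log n) = 8 * Real.log n := by field_simp
    linarith
  exact abs_le_of_sq_le_sq (h1.trans h2) (by positivity)

def inSet {n : ℕ} (G : SimpleGraph (Fin n)) (S : Finset (Fin n)) : Finset (Fin n × Fin n) :=
  (S ×ˢ S).filter fun p => G.Adj p.1 p.2

lemma in_add_cut {n r : ℕ} {G : SimpleGraph (Fin n)} (hreg : isReg r G) (S : Finset (Fin n)) :
    (inSet G S).card + (cutSet G S).card = r * S.card := by
  have h1 : ((S ×ˢ (Finset.univ : Finset (Fin n))).filter fun p => G.Adj p.1 p.2).card = r * S.card := by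
    rw [Finset.card_filter, Finset.sum_product]
    have : ∀ u, ∑ v : Fin n, (if G.Adj u v then 1 else 0) = r := by
      intro u; rw [← Finset.card_filter]; exact hreg u
    simp [this, mul_comm]
  rw [← h1, ← Finset.card_union_of_disjoint]
  · congr 1
    ext p
    simp only [inSet, cutSet, Finset.mem_union, Finset.mem_filter, Finset.mem_product, Finset.mem_compl, Finset.mem_univ]
    tauto
  · rw [Finset.disjoint_left]
    intro p
    simp only [inSet, cutSet, Finset.mem_filter, Finset.mem_product, Finset.mem_compl]
    tauto

lemma cut_compl {n : ℕ} (G : SimpleGraph (Fin n)) (S : Finset (Fin n)) :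
    (cutSet G Sᶜ).card = (cutSet G S).card := by
  refine Finset.card_bij (fun p _ => p.swap) ?_ ?_ ?_
  · intro p
    simp only [cutSet, Finset.mem_filter, Finset.mem_product, Finset.mem_compl, compl_compl, Prod.fst_swap, Prod.snd_swap]
    rintro ⟨⟨h1, h2⟩, h3⟩
    exact ⟨⟨h2, h1⟩, h3.symm⟩
  · intro a _ b _ h; exact Prod.swap_injective h
  · intro p
    simp only [cutSet, Finset.mem_filter, Finset.mem_product, Finset.mem_compl, compl_compl]
    rintro ⟨⟨h1, h2⟩, h3⟩
    exact ⟨p.swap, by simp [h1, h2, h3.symm], by simp⟩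

def cyc {n : ℕ} (x y z w : Fin n) : SimpleGraph (Fin n) :=
  SimpleGraph.fromEdgeSet {s(x, y), s(z, w), s(x, z), s(y, w)}

def sw {n : ℕ} (G : SimpleGraph (Fin n)) (x y z w : Fin n) : SimpleGraph (Fin n) :=
  symmDiff G (cyc x y z w)

lemma sw_adj {n : ℕ} (G : SimpleGraph (Fin n)) {x y z w : Fin n}
    (h1 : x ≠ y) (h2 : z ≠ w) (h3 : x ≠ z) (h4 : x ≠ w) (h5 : y ≠ z) (h6 : y ≠ w)
    (a1 : G.Adj x y) (a2 : G.Adj z w) (a3 : ¬ G.Adj x z) (a4 : ¬ G.Adj y w) (a b : Fin n) :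
    (sw G x y z w).Adj a b ↔
      (G.Adj a b ∧ ¬ ((a = x ∧ b = y) ∨ (a = y ∧ b = x) ∨ (a = z ∧ b = w) ∨ (a = w ∧ b = z))) ∨
      ((a = x ∧ b = z) ∨ (a = z ∧ b = x) ∨ (a = y ∧ b = w) ∨ (a = w ∧ b = y)) := by
  unfold sw symmDiff cyc
  simp only [SimpleGraph.sup_adj, SimpleGraph.sdiff_adj, SimpleGraph.fromEdgeSet_adj,
    Set.mem_insert_iff, Set.mem_singleton_iff, Sym2.eq_iff]
  have a1' := a1.symm
  have a2' := a2.symm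
  have a3' : ¬ G.Adj z x := fun h => a3 h.symm
  have a4' : ¬ G.Adj w y := fun h => a4 h.symm
  grind

lemma sw_reg {n r : ℕ} {G : SimpleGraph (Fin n)} (hreg : isReg r G) {x y z w : Fin n}
    (h1 : x ≠ y) (h2 : z ≠ w) (h3 : x ≠ z) (h4 : x ≠ w) (h5 : y ≠ z) (h6 : y ≠ w)
    (a1 : G.Adj x y) (a2 : G.Adj z w) (a3 : ¬ G.Adj x z) (a4 : ¬ G.Adj y w) :
    isReg r (sw G x y z w) := by
  have hadj := sw_adj G h1 h2 h3 h4 h5 h6 a1 a2 a3 a4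
  have key : ∀ v p q, G.Adj v p → ¬ G.Adj v q →
      (∀ b, (sw G x y z w).Adj v b ↔ (G.Adj v b ∧ b ≠ p) ∨ b = q) →
      (nbr (sw G x y z w) v).card = r := by
    intro v p q hp hq hb
    have e : nbr (sw G x y z w) v = insert q ((nbr G v).erase p) := by
      ext b; simp only [nbr, Finset.mem_filter, Finset.mem_univ, true_and, hb, Finset.mem_insert, Finset.mem_erase]
      tauto
    rw [e, Finset.card_insert_of_notMem (by simp [nbr, hq]),
      Finset.card_erase_of_mem (by simp [nbr, hp])]
    have : 0 < (nbr G v).card := Finset.card_pos.2 ⟨p, by simp [nbr, hp]⟩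
    rw [hreg v] at *; omega
  intro v
  by_cases hx : v = x
  · subst hx; exact key v y z a1 a3 (by intro b; rw [hadj]; grind)
  by_cases hy : v = y
  · subst hy; exact key v x w a1.symm a4 (by intro b; rw [hadj]; grind)
  by_cases hz : v = z
  · subst hz; exact key v w x a2 (fun h => a3 h.symm) (by intro b; rw [hadj]; grind)
  by_cases hw : v = w
  · subst hw; exact key v z y a2.symm (fun h => a4 h.symm) (by intro b; rw [hadj]; grind)
  rw [← hreg v]
  congr 1
  ext b
  simp [nbr, hadj, hx, hy, hz, hw]

lemma sw_cut {n : ℕ} {G : SimpleGraph (Fin n)} (S : Finset (Fin n)) {x y z w : Fin n}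
    (hx : x ∈ S) (hy : y ∈ S) (hz : z ∉ S) (hw : w ∉ S)
    (a1 : G.Adj x y) (a2 : G.Adj z w) (a3 : ¬ G.Adj x z) (a4 : ¬ G.Adj y w) :
    cutSet (sw G x y z w) S = insert (x, z) (insert (y, w) (cutSet G S)) ∧
      (cutSet (sw G x y z w) S).card = (cutSet G S).card + 2 := by
  have h3 : x ≠ z := fun h => hz (h ▸ hx)
  have h4 : x ≠ w := fun h => hw (h ▸ hx)
  have h5 : y ≠ z := fun h => hz (h ▸ hy)
  have h6 : y ≠ w := fun h => hw (h ▸ hy)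
  have hadj := sw_adj G a1.ne a2.ne h3 h4 h5 h6 a1 a2 a3 a4
  have e : cutSet (sw G x y z w) S = insert (x, z) (insert (y, w) (cutSet G S)) := by
    ext ⟨a, b⟩
    simp only [cutSet, Finset.mem_filter, Finset.mem_product, Finset.mem_compl, Finset.mem_insert, hadj, Prod.mk.injEq]
    grind
  refine ⟨e, ?_⟩
  rw [e, Finset.card_insert_of_notMem, Finset.card_insert_of_notMem]
  · simp [cutSet, a4]
  · have := a1.ne
    simp [cutSet, a3, this]

def good {n : ℕ} (G : SimpleGraph (Fin n)) (S : Finset (Fin n)) :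
    Finset ((Fin n × Fin n) × (Fin n × Fin n)) :=
  (inSet G S ×ˢ inSet G Sᶜ).filter fun p => ¬ G.Adj p.1.1 p.2.1 ∧ ¬ G.Adj p.1.2 p.2.2

lemma card_two_step {n r : ℕ} {G : SimpleGraph (Fin n)} (hreg : isReg r G) (x : Fin n) :
    ((Finset.univ : Finset (Fin n × Fin n)).filter fun q => G.Adj x q.1 ∧ G.Adj q.1 q.2).card = r * r := by
  rw [Finset.card_filter, Fintype.sum_prod_type]
  have : ∀ u : Fin n, ∑ v : Fin n, (if G.Adj x u ∧ G.Adj u v then 1 else 0) = if G.Adj x u then r else 0 := by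
    intro u
    by_cases h : G.Adj x u
    · simp only [h, true_and, if_true]; rw [← Finset.card_filter]; exact hreg u
    · simp [h]
  simp only [this]
  rw [← Finset.sum_filter, Finset.sum_const, smul_eq_mul]
  congr 1; exact hreg x

lemma good_card {n r : ℕ} {G : SimpleGraph (Fin n)} (hreg : isReg r G) (S : Finset (Fin n)) :
    (inSet G S).card * ((inSet G Sᶜ).card - 2 * (r * r)) ≤ (good G S).card := by
  unfold good
  rw [Finset.card_filter, Finset.sum_product, ← smul_eq_mul]
  refine Finset.card_nsmul_le_sum _ _ _ ?_
  rintro ⟨x, y⟩ _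
  rw [← Finset.card_filter]
  change _ ≤ ((inSet G Sᶜ).filter fun q => ¬ G.Adj x q.1 ∧ ¬ G.Adj y q.2).card
  set B1 := (Finset.univ : Finset (Fin n × Fin n)).filter fun q => G.Adj x q.1 ∧ G.Adj q.1 q.2
  set B2 := ((Finset.univ : Finset (Fin n × Fin n)).filter fun q => G.Adj y q.1 ∧ G.Adj q.1 q.2).image Prod.swap
  have hB1 : B1.card = r * r := card_two_step hreg x
  have hB2 : B2.card ≤ r * r := Finset.card_image_le.trans (card_two_step hreg y).le
  have hsub : inSet G Sᶜ \ (B1 ∪ B2) ⊆ (inSet G Sᶜ).filter fun q => ¬ G.Adj x q.1 ∧ ¬ G.Adj y q.2 := by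
    rintro ⟨z, w⟩ hq
    simp only [Finset.mem_sdiff, Finset.mem_union, not_or] at hq
    obtain ⟨hq, hq1, hq2⟩ := hq
    have hzw : G.Adj z w := (Finset.mem_filter.mp hq).2
    refine Finset.mem_filter.2 ⟨hq, fun h => hq1 ?_, fun h => hq2 ?_⟩
    · simp [B1, h, hzw]
    · simp only [B2, Finset.mem_image]
      exact ⟨(w, z), by simp [hzw.symm]; exact h, rfl⟩
  have h1 := Finset.card_le_card hsub
  have h2 := Finset.le_card_sdiff (B1 ∪ B2) (inSet G Sᶜ)
  have h3 := Finset.card_union_le B1 B2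
  omega

def NN (r n : ℕ) (S : Finset (Fin n)) (k : ℕ) : Finset (SimpleGraph (Fin n)) :=
  (regSet r n).filter fun G => (cutSet G S).card = k

lemma switch {r n : ℕ} (S : Finset (Fin n)) (k : ℕ) :
    (NN r n S k).card * ((r * S.card - k) * (r * (n - S.card) - k - 2 * (r * r))) ≤
      (NN r n S (k + 2)).card * ((k + 2) * (k + 1)) := by
  set T1 := (NN r n S k).sigma fun G => good G S
  set T2 := (NN r n S (k+2)).sigma fun G => (cutSet G S).offDiag
  have hT1 : (NN r n S k).card * ((r * S.card - k) * (r * (n - S.card) - k - 2 * (r * r))) ≤ T1.card := by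
    rw [Finset.card_sigma, ← smul_eq_mul]
    refine Finset.card_nsmul_le_sum _ _ _ fun G hG => ?_
    obtain ⟨hG1, hG2⟩ := Finset.mem_filter.mp hG
    have hreg := (mem_regSet_iff G).1 hG1
    have e1 := in_add_cut hreg S
    have e2 := in_add_cut hreg Sᶜ
    rw [cut_compl, Finset.card_compl, Fintype.card_fin] at e2
    have e3 := good_card hreg S
    have f1 : (inSet G S).card = r * S.card - k := by omega
    have f2 : (inSet G Sᶜ).card = r * (n - S.card) - k := by omega
    rwa [f1, f2] at e3
  have hT2 : T2.card = (NN r n S (k + 2)).card * ((k + 2) * (k + 1)) := by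
    rw [Finset.card_sigma, ← smul_eq_mul]
    refine Finset.sum_const_nat fun G hG => ?_
    obtain ⟨hG1, hG2⟩ := Finset.mem_filter.mp hG
    rw [Finset.offDiag_card, hG2]
    have : (k + 2) * (k + 2) = (k + 2) * (k + 1) + (k + 2) := by ring
    omega
  rw [← hT2]
  refine hT1.trans ?_
  refine Finset.card_le_card_of_injOn
    (fun p => ⟨sw p.1 p.2.1.1 p.2.1.2 p.2.2.1 p.2.2.2, ((p.2.1.1, p.2.2.1), (p.2.1.2, p.2.2.2))⟩) ?_ ?_
  · rintro ⟨G, ⟨⟨x, y⟩, ⟨z, w⟩⟩⟩ hp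
    simp only [T1, Finset.coe_sigma, Set.mem_sigma_iff, Finset.mem_coe, good, inSet, NN, Finset.mem_filter,
      Finset.mem_product, Finset.mem_compl] at hp
    obtain ⟨⟨hG1, hG2⟩, ⟨⟨⟨hx, hy⟩, a1⟩, ⟨⟨hz, hw⟩, a2⟩⟩, a3, a4⟩ := hp
    have h3 : x ≠ z := fun h => hz (h ▸ hx)
    have h4 : x ≠ w := fun h => hw (h ▸ hx)
    have h5 : y ≠ z := fun h => hz (h ▸ hy)
    have h6 : y ≠ w := fun h => hw (h ▸ hy)
    obtain ⟨c1, c2⟩ := sw_cut S hx hy hz hw a1 a2 a3 a4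
    have hreg := sw_reg ((mem_regSet_iff G).1 hG1) a1.ne a2.ne h3 h4 h5 h6 a1 a2 a3 a4
    simp only [T2, Finset.coe_sigma, Set.mem_sigma_iff, Finset.mem_coe, NN, Finset.mem_filter, Finset.mem_offDiag]
    refine ⟨⟨(mem_regSet_iff _).2 hreg, by rw [c2, hG2]⟩, ?_, ?_, ?_⟩
    · rw [c1]; simp
    · rw [c1]; simp
    · intro h; exact a1.ne (Prod.ext_iff.1 h).1
  · rintro ⟨G, ⟨⟨x, y⟩, ⟨z, w⟩⟩⟩ _ ⟨G', ⟨⟨x', y'⟩, ⟨z', w'⟩⟩⟩ _ h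
    simp only [Sigma.mk.injEq, heq_eq_eq, Prod.mk.injEq] at h
    obtain ⟨h1, ⟨rfl, rfl⟩, rfl, rfl⟩ := h
    have : G = G' := symmDiff_left_injective _ h1
    subst this; rfl

lemma iterate {r n : ℕ} (S : Finset (Fin n)) (k A B : ℕ) (hA : 2 * A ≤ r * S.card - k)
    (hB : 2 * B ≤ r * (n - S.card) - k - 2 * (r * r)) (m : ℕ) :
    (NN r n S k).card * (A.choose m * B.choose m) ≤
      (NN r n S (k + 2 * m)).card * (k + 2 * m).choose k := by
  induction m with
  | zero => simp
  | succ m ih =>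
    have hs := switch (r := r) S (k + 2 * m)
    set N0 := (NN r n S k).card
    set N1 := (NN r n S (k + 2 * m)).card
    have e : k + 2 * (m + 1) = k + 2 * m + 2 := by ring
    rw [e]
    set N2 := (NN r n S (k + 2 * m + 2)).card
    have c1 : A.choose (m+1) * (m+1) = A.choose m * (A - m) := Nat.choose_succ_right_eq A m
    have c2 : B.choose (m+1) * (m+1) = B.choose m * (B - m) := Nat.choose_succ_right_eq B m
    have c3 : (k + 2 * m + 2).choose k * ((2 * m + 2) * (2 * m + 1)) =
        (k + 2 * m).choose k * ((k + 2 * m + 2) * (k + 2 * m + 1)) := by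
      have q1 := Nat.choose_mul_succ_eq (k + 2 * m) k
      have q2 := Nat.choose_mul_succ_eq (k + 2 * m + 1) k
      have r1 : k + 2 * m + 1 - k = 2 * m + 1 := by omega
      have r2 : k + 2 * m + 1 + 1 - k = 2 * m + 2 := by omega
      rw [r1] at q1
      rw [r2] at q2
      calc _ = (k + 2 * m + 1 + 1).choose k * (2 * m + 2) * (2 * m + 1) := by ring
        _ = (k + 2 * m + 1).choose k * (2 * m + 1) * (k + 2 * m + 1 + 1) := by rw [← q2]; ring
        _ = _ := by rw [← q1]; ring
    have hs' : N1 * ((2 * (A - m)) * (2 * (B - m))) ≤ N2 * ((k + 2 * m + 2) * (k + 2 * m + 1)) := by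
      refine le_trans ?_ hs
      gcongr
      · omega
      · omega
    have main : N0 * (A.choose (m+1) * B.choose (m+1)) * (4 * ((m+1) * (m+1))) ≤
        N2 * (k + 2 * m + 2).choose k * (4 * ((m+1) * (m+1))) := by
      calc _ = 4 * (N0 * ((A.choose (m+1) * (m+1)) * (B.choose (m+1) * (m+1)))) := by ring
        _ = (N0 * (A.choose m * B.choose m)) * ((2 * (A - m)) * (2 * (B - m))) := by rw [c1, c2]; ring
        _ ≤ (N1 * (k + 2 * m).choose k) * ((2 * (A - m)) * (2 * (B - m))) := Nat.mul_le_mul_right _ ih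
        _ = (k + 2 * m).choose k * (N1 * ((2 * (A - m)) * (2 * (B - m)))) := by ring
        _ ≤ (k + 2 * m).choose k * (N2 * ((k + 2 * m + 2) * (k + 2 * m + 1))) := Nat.mul_le_mul_left _ hs'
        _ = N2 * ((k + 2 * m + 2).choose k * ((2 * m + 2) * (2 * m + 1))) := by rw [c3]; ring
        _ ≤ N2 * ((k + 2 * m + 2).choose k * (4 * ((m+1) * (m+1)))) := by
            refine Nat.mul_le_mul_left _ (Nat.mul_le_mul_left _ ?_)
            nlinarith
        _ = _ := by ring
    exact Nat.le_of_mul_le_mul_right main (by positivity)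

lemma vander (A B : ℕ) : ∑ m ∈ Finset.range (A + 1), A.choose m * B.choose m = (A + B).choose A := by
  rw [Nat.add_choose_eq, Finset.Nat.sum_antidiagonal_eq_sum_range_succ (fun i j => A.choose i * B.choose j),
    ← Finset.sum_range_reflect]
  refine Finset.sum_congr rfl fun m hm => ?_
  have : m ≤ A := by simp at hm; omega
  have e : A + 1 - 1 - m = A - m := by omega
  rw [e, Nat.choose_symm this]

lemma NN_sum_le {r n : ℕ} (S : Finset (Fin n)) (k M : ℕ) :
    ∑ m ∈ Finset.range M, (NN r n S (k + 2 * m)).card ≤ (regSet r n).card := by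
  rw [← Finset.card_biUnion]
  · refine Finset.card_le_card ?_
    intro G hG
    obtain ⟨m, _, hm⟩ := Finset.mem_biUnion.mp hG
    exact (Finset.mem_filter.mp hm).1
  · intro i _ j _ hij
    rw [Function.onFun, Finset.disjoint_left]
    intro G h1 h2
    have e1 := (Finset.mem_filter.mp h1).2
    have e2 := (Finset.mem_filter.mp h2).2
    omega

lemma NN_bound {r n : ℕ} (S : Finset (Fin n)) (k A B : ℕ) (hk : k ≤ r * S.card) (hA : 2 * A ≤ r * S.card - k)
    (hB : 2 * B ≤ r * (n - S.card) - k - 2 * (r * r)) :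
    (NN r n S k).card * (A + B).choose A ≤ (regSet r n).card * (r * S.card).choose k := by
  rw [← vander, Finset.mul_sum]
  calc _ ≤ ∑ m ∈ Finset.range (A + 1), (NN r n S (k + 2 * m)).card * (r * S.card).choose k := by
        refine Finset.sum_le_sum fun m hm => (iterate S k A B hA hB m).trans ?_
        have : m ≤ A := by simp at hm; omega
        exact Nat.mul_le_mul_left _ (Nat.choose_le_choose k (by omega))
    _ ≤ _ := by
        rw [← Finset.sum_mul]
        exact Nat.mul_le_mul_right _ (NN_sum_le S k _)

lemma gain_two (a A B : ℕ) (h1 : a ≤ A) (h2 : a ≤ B) : 2 ^ a ≤ (A + B).choose A := by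
  rw [← vander, ← Nat.sum_range_choose]
  calc _ ≤ ∑ m ∈ Finset.range (a + 1), A.choose m * B.choose m := by
        refine Finset.sum_le_sum fun m hm => ?_
        have hm' : m ≤ a := by simp at hm; omega
        calc _ = a.choose m * 1 := (mul_one _).symm
          _ ≤ _ := Nat.mul_le_mul (Nat.choose_le_choose m h1) (Nat.choose_pos (by omega))
    _ ≤ _ := Finset.sum_le_sum_of_subset (Finset.range_mono (by omega))

lemma gain_lin (A B : ℕ) (h1 : 1 ≤ A) : B ≤ (A + B).choose A := by
  rw [← vander]
  calc B ≤ A.choose 1 * B.choose 1 := by simp; nlinarith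
    _ ≤ _ := Finset.single_le_sum (f := fun m => A.choose m * B.choose m) (fun _ _ => Nat.zero_le _)
      (Finset.mem_range.2 (by omega))

lemma super_vander (s t A B : ℕ) : (s + t).choose s * (A + B).choose A ≤ ((s + A) + (t + B)).choose (s + A) := by
  have e : (s + A) + (t + B) = (s + t) + (A + B) := by ring
  rw [e, Nat.add_choose_eq (s + t) (A + B)]
  exact Finset.single_le_sum (f := fun ij : ℕ × ℕ => (s + t).choose ij.1 * (A + B).choose ij.2)
    (fun _ _ => Nat.zero_le _) (a := (s, A)) (Finset.HasAntidiagonal.mem_antidiagonal.2 rfl)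

lemma NN_bound2 {r n : ℕ} (hr : 3 ≤ r) (S : Finset (Fin n)) (k : ℕ) (hs : 2 ≤ S.card) (hsn : 2 * S.card ≤ n)
    (hk : 4 * k ≤ S.card) (hn : 8 * (r * r) + 4 ≤ n) :
    ∃ g : ℕ, n ≤ 16 * g ∧ 2 ^ ((S.card + 7) / 8) ≤ g ∧
      (NN r n S k).card * (n.choose S.card * g) ≤ (regSet r n).card * (r * S.card).choose k := by
  set s := S.card with hsd
  have f1 : 3 * s ≤ r * s := Nat.mul_le_mul_right _ hr
  have f2 : 3 * (n - s) ≤ r * (n - s) := Nat.mul_le_mul_right _ hr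
  obtain ⟨A, hA⟩ : ∃ A, A = (r * s - k) / 2 - s := ⟨_, rfl⟩
  obtain ⟨B, hB⟩ : ∃ B, B = (r * (n - s) - k - 2 * (r * r)) / 2 - (n - s) := ⟨_, rfl⟩
  have hA8 : s ≤ 8 * A := by omega
  have hB8 : n - s ≤ 8 * B := by omega
  have hb := NN_bound (r := r) S k (s + A) ((n - s) + B) (by change k ≤ r * s; omega) (by change 2 * (s + A) ≤ r * s - k; omega)
    (by change 2 * ((n - s) + B) ≤ r * (n - s) - k - 2 * (r * r); omega)
  have hv := super_vander s (n - s) A B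
  rw [show s + (n - s) = n by omega] at hv
  refine ⟨(A + B).choose A, ?_, gain_two _ A B (by omega) (by omega), ?_⟩
  · have := gain_lin A B (by omega)
    omega
  · exact (Nat.mul_le_mul_left _ hv).trans hb

lemma choose_small (ψ : ℝ) (hψ : 1 < ψ) (r : ℕ) : ∃ L : ℕ, 4 ≤ L ∧ ∀ s k : ℕ, k * L ≤ s →
    ((r * s).choose k : ℝ) ≤ ψ ^ (2 * s) := by
  obtain ⟨x, hx0, hx⟩ : ∃ x : ℝ, 0 < x ∧ (1 + x) ^ r ≤ ψ := by
    have hc : Tendsto (fun x : ℝ => (1 + x) ^ r) (nhdsWithin 0 (Set.Ioi 0)) (nhds 1) := by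
      have : Continuous (fun x : ℝ => (1 + x) ^ r) := by fun_prop
      have h := this.tendsto 0
      simp only [add_zero, one_pow] at h
      exact h.mono_left nhdsWithin_le_nhds
    have h1 := (hc.eventually (gt_mem_nhds hψ)).and self_mem_nhdsWithin
    obtain ⟨x, hx, hx0⟩ := h1.exists
    exact ⟨x, hx0, hx.le⟩
  obtain ⟨L0, hL0⟩ := pow_unbounded_of_one_lt x⁻¹ hψ
  refine ⟨L0 + 4, by omega, fun s k hk => ?_⟩
  have h1 : ((r * s).choose k : ℝ) * x ^ k ≤ (1 + x) ^ (r * s) := by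
    by_cases hkr : k ≤ r * s
    · rw [add_comm, add_pow]
      have := Finset.single_le_sum (f := fun m => x ^ m * 1 ^ (r * s - m) * ((r * s).choose m : ℝ))
        (s := Finset.range (r * s + 1)) (fun _ _ => by positivity) (a := k) (by simp; omega)
      simp only [one_pow, mul_one] at this ⊢
      rw [mul_comm]; exact this
    · rw [Nat.choose_eq_zero_of_lt (by omega)]; simp; positivity
  have h2 : x⁻¹ ^ k ≤ ψ ^ s := by
    calc x⁻¹ ^ k ≤ (ψ ^ L0) ^ k := by gcongr
      _ = ψ ^ (k * L0) := by rw [← pow_mul, mul_comm]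
      _ ≤ ψ ^ s := pow_le_pow_right₀ hψ.le (by nlinarith)
  calc ((r * s).choose k : ℝ) = ((r * s).choose k : ℝ) * x ^ k * x⁻¹ ^ k := by
        rw [mul_assoc, ← mul_pow, mul_inv_cancel₀ hx0.ne', one_pow, mul_one]
    _ ≤ (1 + x) ^ (r * s) * ψ ^ s := by gcongr
    _ = ((1 + x) ^ r) ^ s * ψ ^ s := by rw [pow_mul]
    _ ≤ ψ ^ s * ψ ^ s := by gcongr
    _ = _ := by rw [← pow_add]; ring_nf

lemma cut_singleton {n r : ℕ} {G : SimpleGraph (Fin n)} (hreg : isReg r G) (v : Fin n) :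
    (cutSet G {v}).card = r := by
  have h := in_add_cut hreg {v}
  have : inSet G {v} = ∅ := by
    ext ⟨a, b⟩
    simp only [inSet, Finset.mem_filter, Finset.mem_product, Finset.mem_singleton, Finset.notMem_empty, iff_false]
    rintro ⟨⟨h1, h2⟩, h3⟩
    exact h3.ne (h1.trans h2.symm)
  simpa [this] using h

lemma NN_bound3 {r n L : ℕ} {ψ : ℝ} (hψ : 1 < ψ) (hψ64 : ψ ^ 64 = 2) (hL : 4 ≤ L)
    (hcs : ∀ s k : ℕ, k * L ≤ s → ((r * s).choose k : ℝ) ≤ ψ ^ (2 * s))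
    (hr : 3 ≤ r) (S : Finset (Fin n)) (k : ℕ) (hs : 2 ≤ S.card) (hsn : 2 * S.card ≤ n)
    (hk : k * L ≤ S.card) (hn : 8 * (r * r) + 4 ≤ n) :
    ((NN r n S k).card : ℝ) ≤ (regSet r n).card * (4 / √n) * ((n.choose S.card : ℝ)⁻¹ * (ψ⁻¹ ^ 2) ^ S.card) := by
  obtain ⟨g, hg1, hg2, hg3⟩ := NN_bound2 hr S k hs hsn (by nlinarith) hn
  set s := S.card with hsd
  have hψ0 : 0 < ψ := by linarith
  have hn0 : (0:ℝ) < n := by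
    have : 0 < n := by omega
    exact_mod_cast this
  have hG1 : (n:ℝ) ≤ 16 * g := by exact_mod_cast hg1
  have hG2 : ψ ^ (8 * s) ≤ g := by
    calc ψ ^ (8 * s) ≤ ψ ^ (64 * ((s + 7) / 8)) := pow_le_pow_right₀ hψ.le (by omega)
      _ = 2 ^ ((s + 7) / 8) := by rw [pow_mul, hψ64]
      _ ≤ g := by exact_mod_cast hg2
  have hG3 : ψ ^ (4 * s) * (√n / 4) ≤ g := by
    have hs2 : (√(n:ℝ)) ^ 2 = n := Real.sq_sqrt hn0.le
    have : (ψ ^ (4 * s) * (√n / 4)) ^ 2 ≤ (g:ℝ) ^ 2 := by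
      calc _ = ψ ^ (8 * s) * (n / 16) := by rw [mul_pow, div_pow, hs2, ← pow_mul]; ring_nf
        _ ≤ g * g := by
          gcongr
          linarith
        _ = _ := by ring
    exact (sq_le_sq₀ (by positivity) (by positivity)).1 this
  have hch : (0:ℝ) < n.choose s := by
    have := Nat.choose_pos (n := n) (k := s) (by omega)
    exact_mod_cast this
  have hsq : 0 < √(n:ℝ) := Real.sqrt_pos.2 hn0
  have h3 : ((NN r n S k).card : ℝ) * (n.choose s * g) ≤ (regSet r n).card * (r * s).choose k := by
    exact_mod_cast hg3
  have h4 : ((NN r n S k).card : ℝ) * (n.choose s * (ψ ^ (4 * s) * (√n / 4))) ≤ (regSet r n).card * ψ ^ (2 * s) := by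
    calc _ ≤ ((NN r n S k).card : ℝ) * (n.choose s * g) := by gcongr
      _ ≤ _ := h3
      _ ≤ _ := by
        have := hcs s k hk
        gcongr
  rw [← le_div_iff₀ (by positivity)] at h4
  refine h4.trans (le_of_eq ?_)
  have e : ψ ^ (4 * s) = ψ ^ (2 * s) * ψ ^ (2 * s) := by rw [← pow_add]; ring_nf
  rw [e, ← pow_mul, inv_pow]
  field_simp

lemma bad_bound {r n L : ℕ} {ψ : ℝ} (hψ : 1 < ψ) (hψ64 : ψ ^ 64 = 2) (hL : 4 ≤ L)
    (hcs : ∀ s k : ℕ, k * L ≤ s → ((r * s).choose k : ℝ) ≤ ψ ^ (2 * s))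
    (hr : 3 ≤ r) (hn : 8 * (r * r) + 4 ≤ n) :
    (((regSet r n).filter fun G => ¬ expands (1 / L : ℝ) G).card : ℝ) ≤
      (regSet r n).card * (4 / √n) * ∑' s : ℕ, (s : ℝ) * (ψ⁻¹ ^ 2) ^ s := by
  have hψ0 : 0 < ψ := by linarith
  have hLp : (0:ℝ) < L := by
    have : 0 < L := by omega
    exact_mod_cast this
  set I := (Finset.univ : Finset (Finset (Fin n))).filter fun S => 2 ≤ S.card ∧ 2 * S.card ≤ n with hI
  set J : Finset (Fin n) → Finset ℕ := fun S => (Finset.range S.card).filter fun k => k * L ≤ S.card with hJ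
  have hsub : ((regSet r n).filter fun G => ¬ expands (1 / L : ℝ) G) ⊆
      I.biUnion fun S => (J S).biUnion fun k => NN r n S k := by
    intro G hG
    obtain ⟨hG1, hG2⟩ := Finset.mem_filter.mp hG
    have hreg := (mem_regSet_iff G).1 hG1
    unfold expands at hG2
    push Not at hG2
    obtain ⟨S, hS1, hS2⟩ := hG2
    have hlt : (cutSet G S).card * L < S.card := by
      rw [one_div, ← div_eq_inv_mul, lt_div_iff₀ hLp] at hS2
      exact_mod_cast hS2
    have h2 : 2 ≤ S.card := by
      by_contra hcon
      have h1 : S.card = 1 := by omega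
      obtain ⟨v, rfl⟩ := Finset.card_eq_one.1 h1
      rw [cut_singleton hreg] at hlt
      nlinarith
    simp only [Finset.mem_biUnion]
    refine ⟨S, by simp [hI, h2, hS1], (cutSet G S).card, ?_, Finset.mem_filter.2 ⟨hG1, rfl⟩⟩
    simp only [hJ, Finset.mem_filter, Finset.mem_range]
    exact ⟨by nlinarith, hlt.le⟩
  set F : ℕ → ℝ := fun s => (regSet r n).card * (4 / √n) * ((n.choose s : ℝ)⁻¹ * (s * (ψ⁻¹ ^ 2) ^ s)) with hF
  have hF0 : ∀ s, 0 ≤ F s := fun s => by positivity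
  have h1 : (((regSet r n).filter fun G => ¬ expands (1 / L : ℝ) G).card : ℝ) ≤ ∑ S ∈ I, F S.card := by
    calc _ ≤ ((∑ S ∈ I, ∑ k ∈ J S, (NN r n S k).card : ℕ) : ℝ) := by
          refine Nat.cast_le.2 ((Finset.card_le_card hsub).trans (Finset.card_biUnion_le.trans ?_))
          exact Finset.sum_le_sum fun S _ => Finset.card_biUnion_le
      _ = ∑ S ∈ I, ∑ k ∈ J S, ((NN r n S k).card : ℝ) := by push_cast; rfl
      _ ≤ ∑ S ∈ I, ∑ k ∈ J S, (regSet r n).card * (4 / √n) * ((n.choose S.card : ℝ)⁻¹ * (ψ⁻¹ ^ 2) ^ S.card) := by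
          refine Finset.sum_le_sum fun S hS => Finset.sum_le_sum fun k hk => ?_
          simp only [hI, Finset.mem_filter, Finset.mem_univ, true_and] at hS
          simp only [hJ, Finset.mem_filter] at hk
          exact NN_bound3 hψ hψ64 hL hcs hr S k hS.1 hS.2 hk.2 hn
      _ ≤ ∑ S ∈ I, F S.card := by
          refine Finset.sum_le_sum fun S _ => ?_
          rw [Finset.sum_const, nsmul_eq_mul]
          have hc : ((J S).card : ℝ) ≤ S.card := by
            have := Finset.card_filter_le (Finset.range S.card) (fun k => k * L ≤ S.card)
            rw [Finset.card_range] at this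
            exact_mod_cast this
          calc _ ≤ (S.card : ℝ) * ((regSet r n).card * (4 / √n) * ((n.choose S.card : ℝ)⁻¹ * (ψ⁻¹ ^ 2) ^ S.card)) := by
                gcongr
            _ = _ := by simp only [hF]; ring
  have h2 : ∑ S ∈ I, F S.card ≤ ∑ S : Finset (Fin n), F S.card :=
    Finset.sum_le_sum_of_subset_of_nonneg (Finset.subset_univ _) (fun S _ _ => hF0 _)
  have h3 : ∑ S : Finset (Fin n), F S.card = (regSet r n).card * (4 / √n) * ∑ s ∈ Finset.range (n + 1),
      (s:ℝ) * (ψ⁻¹ ^ 2) ^ s := by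
    rw [Finset.mul_sum, ← Finset.powerset_univ, Finset.sum_powerset_apply_card, Finset.card_univ, Fintype.card_fin]
    refine Finset.sum_congr rfl fun s hs => ?_
    have hch : (0:ℝ) < n.choose s := by
      have := Nat.choose_pos (n := n) (k := s) (by simp at hs; omega)
      exact_mod_cast this
    simp only [hF, nsmul_eq_mul]
    field_simp
  have hsum : Summable fun s : ℕ => (s : ℝ) * (ψ⁻¹ ^ 2) ^ s := by
    have := summable_pow_mul_geometric_of_norm_lt_one 1 (r := ψ⁻¹ ^ 2) (by
      rw [Real.norm_of_nonneg (by positivity)]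
      exact pow_lt_one₀ (by positivity) (inv_lt_one_of_one_lt₀ hψ) (by norm_num))
    simpa using this
  refine h1.trans (h2.trans (h3.le.trans ?_))
  gcongr
  exact hsum.sum_le_tsum _ (fun s _ => by positivity)

def stepSet (r n : ℕ) : Finset ℕ :=
  (Finset.Icc 1 (r / 2) ∪ Finset.Ico (n - r / 2) n) ∪ (if r % 2 = 1 then {n / 2} else ∅)

lemma mem_stepSet (r n i : ℕ) : i ∈ stepSet r n ↔
    (1 ≤ i ∧ i ≤ r / 2) ∨ (n - r / 2 ≤ i ∧ i < n) ∨ (r % 2 = 1 ∧ i = n / 2) := by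
  unfold stepSet
  split_ifs with h
  · simp [h]; tauto
  · simp [h]

lemma stepSet_card (r n : ℕ) (hn : r + 2 ≤ n) : (stepSet r n).card = r := by
  unfold stepSet
  have d1 : Disjoint (Finset.Icc 1 (r / 2)) (Finset.Ico (n - r / 2) n) := by
    rw [Finset.disjoint_left]; intro i; simp only [Finset.mem_Icc, Finset.mem_Ico]; omega
  have d2 : Disjoint (Finset.Icc 1 (r / 2) ∪ Finset.Ico (n - r / 2) n) (if r % 2 = 1 then {n / 2} else ∅) := by
    split_ifs
    · rw [Finset.disjoint_singleton_right]
      simp only [Finset.mem_union, Finset.mem_Icc, Finset.mem_Ico]; omega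
    · simp
  rw [Finset.card_union_of_disjoint d2, Finset.card_union_of_disjoint d1, Nat.card_Icc, Nat.card_Ico]
  split_ifs <;> simp <;> omega

lemma mem_nbr_iff {n : ℕ} (G : SimpleGraph (Fin n)) (v u : Fin n) : u ∈ nbr G v ↔ G.Adj v u := by simp [nbr]

lemma regSet_nonempty {r n : ℕ} (hn : r + 2 ≤ n) (he : Even (r * n)) : (regSet r n).Nonempty := by
  have hpar : r % 2 = 1 → n % 2 = 0 := by
    intro h
    rcases Nat.even_mul.1 he with h1 | h1
    · rw [Nat.even_iff] at h1; omega
    · exact Nat.even_iff.1 h1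
  let dd : Fin n → Fin n → ℕ := fun u v => if u.1 ≤ v.1 then v.1 - u.1 else v.1 + n - u.1
  have hdd : ∀ u v, dd u v = if u.1 ≤ v.1 then v.1 - u.1 else v.1 + n - u.1 := fun _ _ => rfl
  let G : SimpleGraph (Fin n) :=
    { Adj := fun u v => dd u v ∈ stepSet r n
      symm := ⟨by
        intro u v h
        rw [mem_stepSet, hdd] at *
        have := u.2
        have := v.2
        split_ifs at * <;> omega⟩
      loopless := ⟨by
        intro u h
        rw [mem_stepSet, hdd] at h
        simp at h
        omega⟩ }
  refine ⟨G, (mem_regSet_iff G).2 fun u => ?_⟩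
  rw [← stepSet_card r n hn]
  refine Finset.card_bij (fun v _ => dd u v) ?_ ?_ ?_
  · intro v hv; exact (mem_nbr_iff G u v).1 hv
  · intro a _ b _ h
    simp only [hdd] at h
    have := u.2
    have := a.2
    have := b.2
    apply Fin.ext
    split_ifs at h <;> omega
  · intro i hi
    have hi' := (mem_stepSet r n i).1 hi
    have hin : i < n := by omega
    have hu := u.2
    by_cases h : u.1 + i < n
    · have e : dd u ⟨u.1 + i, h⟩ = i := by simp [hdd]
      exact ⟨⟨u.1 + i, h⟩, (mem_nbr_iff G u _).2 (by change dd _ _ ∈ _; rwa [e]), e⟩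
    · have e : dd u ⟨u.1 + i - n, by omega⟩ = i := by
        rw [hdd]; simp only; split_ifs <;> omega
      exact ⟨⟨u.1 + i - n, by omega⟩, (mem_nbr_iff G u _).2 (by change dd _ _ ∈ _; rwa [e]), e⟩

/-- **Lemma 6.** For a random `r`-regular graph `G` on `n` vertices (`r ≥ 3`
fixed), the lazy non-backtracking walk chain on the `rn` oriented edges of `G`
has mixing time `O(log n)`: there is a constant `C > 0` such that w.h.p.
(over `G`), for all `t ≥ C·log n` and all oriented edges `e, f`,
`|P^t_e(f) − 1/(rn)| ≤ n^{−4}`. -/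
theorem nb_chain_mixing_time (r : ℕ) (hr : 3 ≤ r) :
    ∃ C : ℝ, 0 < C ∧
      Tendsto (fun n : ℕ => graphProb r n (fun G =>
          ∀ t : ℕ, C * Real.log n ≤ (t : ℝ) →
            ∀ e f : G.Dart,
              |((nbLazy r G) ^ t) e f - ((r : ℝ) * n)⁻¹| ≤ (((n : ℝ)) ^ 4)⁻¹))
        (regFilter r) (nhds 1) := by
  set ψ : ℝ := (2:ℝ) ^ (1 / 64 : ℝ) with hψd
  have hψ : 1 < ψ := Real.one_lt_rpow (by norm_num) (by norm_num)
  have hψ64 : ψ ^ 64 = 2 := by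
    rw [hψd, ← Real.rpow_natCast, ← Real.rpow_mul (by norm_num)]; norm_num
  obtain ⟨L, hL, hcs⟩ := choose_small ψ hψ r
  have hLp : (0:ℝ) < 1 / L := by
    have : 0 < L := by omega
    have : (0:ℝ) < L := by exact_mod_cast this
    positivity
  refine ⟨8 / gam r (1 / L), div_pos (by norm_num) (gam_pos hr hLp), ?_⟩
  set K := ∑' s : ℕ, (s : ℝ) * (ψ⁻¹ ^ 2) ^ s with hK
  have hlim : Tendsto (fun n : ℕ => 1 - 4 / √(n:ℝ) * K) (regFilter r) (nhds 1) := by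
    have h1 : Tendsto (fun n : ℕ => 4 / √(n:ℝ)) atTop (nhds 0) :=
      (Real.tendsto_sqrt_atTop.comp tendsto_natCast_atTop_atTop).const_div_atTop 4
    have h2 := (h1.mul_const K).const_sub 1
    rw [zero_mul, sub_zero] at h2
    exact h2.mono_left inf_le_left
  have hev : ∀ᶠ n in regFilter r, 8 * (r * r) + 4 + r ≤ n ∧ Even (r * n) := by
    unfold regFilter
    rw [Filter.eventually_inf_principal]
    filter_upwards [eventually_ge_atTop (8 * (r * r) + 4 + r)] with n hn he
    exact ⟨hn, he⟩
  refine tendsto_of_tendsto_of_tendsto_of_le_of_le' hlim tendsto_const_nhds ?_ ?_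
  · filter_upwards [hev] with n hn
    have hne := regSet_nonempty (r := r) (n := n) (by omega) hn.2
    have hN : (0:ℝ) < (regSet r n).card := by exact_mod_cast hne.card_pos
    have hbad := bad_bound (n := n) hψ hψ64 hL hcs hr (by omega)
    have hsplit := Finset.card_filter_add_card_filter_not (s := regSet r n) (fun G => expands (1 / L : ℝ) G)
    have hsplit' : (((regSet r n).filter fun G => expands (1 / L : ℝ) G).card : ℝ) +
      ((regSet r n).filter fun G => ¬ expands (1 / L : ℝ) G).card = (regSet r n).card := by
      exact_mod_cast hsplit
    unfold graphProb
    rw [le_div_iff₀ hN]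
    calc (1 - 4 / √(n:ℝ) * K) * (regSet r n).card ≤ ((regSet r n).filter fun G => expands (1 / L : ℝ) G).card := by
          rw [← hK] at hbad
          nlinarith
      _ ≤ _ := by
          refine Nat.cast_le.2 (Finset.card_le_card ?_)
          intro G hG
          obtain ⟨hG1, hG2⟩ := Finset.mem_filter.mp hG
          refine Finset.mem_filter.2 ⟨hG1, fun t ht e f => ?_⟩
          exact mixing hLp hr (by omega) ((mem_regSet_iff G).1 hG1) hG2 t ht e f
  · filter_upwards with n
    unfold graphProb
    exact div_le_one_of_le₀ (Nat.cast_le.2 (Finset.card_filter_le _ _)) (Nat.cast_nonneg _)
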